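/- arXiv:2312.15596 — 3 statements merged into one kernel-verified Lean document; each statement's English description precedes it below -/
import Mathlib

section
/- Let H = (V, E) be a finite undirected graph and let PSG be the partially specified digraph constructed from H as in the context. Then H is 3-colorable if and only if PSG has an instantiation G such that ≡_G induces no more than 3·|V| equivalence classes. -/
/-- The number of equivalence classes induced by a relation `r`. -/
noncomputable def numClasses {γ : Type*} (r : γ → γ → Prop) : ℕ :=
  Nat.card (Set.range fun u => {v | r u v})

/-- Indistinguishability `u ≡_G v` of two vertices in a digraph whose vertex
set is all of `γ` and whose edge set is `Eg ⊆ γ × λ × γ`: for every label `a`,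
the four edges `(u,a,u)`, `(u,a,v)`, `(v,a,u)`, `(v,a,v)` are all present or
all absent, and for every `x ∉ {u,v}`, `(u,a,x) ∈ Eg ↔ (v,a,x) ∈ Eg` and
`(x,a,u) ∈ Eg ↔ (x,a,v) ∈ Eg`. -/
def indistE {γ l : Type*} (Eg : Set (γ × l × γ)) (u v : γ) : Prop :=
  ∀ a : l,
    (((u, a, u) ∈ Eg ∧ (u, a, v) ∈ Eg ∧ (v, a, u) ∈ Eg ∧ (v, a, v) ∈ Eg) ∨
     ((u, a, u) ∉ Eg ∧ (u, a, v) ∉ Eg ∧ (v, a, u) ∉ Eg ∧ (v, a, v) ∉ Eg)) ∧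
    ∀ x : γ, x ≠ u → x ≠ v →
      (((u, a, x) ∈ Eg ↔ (v, a, x) ∈ Eg) ∧ ((x, a, u) ∈ Eg ↔ (x, a, v) ∈ Eg))

namespace DBPMReduction

variable {V : Type*} (H : SimpleGraph V)

/-- The access rights of the constructed PSG: `a_v` for `v ∈ V` and `b_e`
for `e ∈ E(H)`. -/
def Lab : Type _ := V ⊕ H.edgeSet

/-- The vertices of the constructed PSG: `x_{v,i}`, `y_v`, and `z_{e,i}`. -/
def Vert : Type _ := (V × Fin 3) ⊕ V ⊕ (H.edgeSet × Fin 3)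

/-- The vertex `x_{v,i}`. -/
def xv (v : V) (i : Fin 3) : Vert H := Sum.inl (v, i)
/-- The vertex `y_v`. -/
def yv (v : V) : Vert H := Sum.inr (Sum.inl v)
/-- The vertex `z_{e,i}`. -/
def zv (e : H.edgeSet) (i : Fin 3) : Vert H := Sum.inr (Sum.inr (e, i))
/-- The access right `a_v`. -/
def av (v : V) : Lab H := Sum.inl v
/-- The access right `b_e`. -/
def bv (e : H.edgeSet) : Lab H := Sum.inr e

/-- The edges `E(PSG)` of the constructed partially specified digraph. -/
def Epsg : Set (Vert H × Lab H × Vert H) :=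
  {t | (∃ v i, t = (xv H v i, av H v, xv H v i)) ∨
       (∃ v, t = (yv H v, av H v, yv H v)) ∨
       (∃ e i, t = (zv H e i, bv H e, zv H e i))}

/-- The non-edges `F(PSG)` of the constructed partially specified digraph. -/
def Fpsg : Set (Vert H × Lab H × Vert H) :=
  {t | (∃ u v i, u ≠ v ∧ t = (xv H v i, av H u, xv H v i)) ∨
       (∃ v i j, i ≠ j ∧ t = (xv H v i, av H v, xv H v j)) ∨
       (∃ u v, u ≠ v ∧ t = (yv H v, av H u, yv H v)) ∨
       (∃ (v : V) (e : H.edgeSet), v ∈ (e : Sym2 V) ∧ t = (yv H v, bv H e, yv H v)) ∨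
       (∃ (u : V) (e : H.edgeSet) (i : Fin 3), u ∉ (e : Sym2 V) ∧ t = (zv H e i, av H u, zv H e i)) ∨
       (∃ (v : V) (e : H.edgeSet) (i j : Fin 3), v ∈ (e : Sym2 V) ∧ i ≠ j ∧
         (t = (zv H e i, av H v, xv H v j) ∨ t = (xv H v j, av H v, zv H e i)))}

theorem indistE_refl {γ l : Type*} (Eg : Set (γ × l × γ)) (u : γ) : indistE Eg u u := by
  intro a
  refine ⟨by tauto, fun x _ _ => ⟨Iff.rfl, Iff.rfl⟩⟩

theorem indistE_iff {γ l : Type*} (Eg : Set (γ × l × γ)) (u v : γ) :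
    indistE Eg u v ↔ ∀ a : l,
    (((u, a, u) ∈ Eg ∧ (u, a, v) ∈ Eg ∧ (v, a, u) ∈ Eg ∧ (v, a, v) ∈ Eg) ∨
     ((u, a, u) ∉ Eg ∧ (u, a, v) ∉ Eg ∧ (v, a, u) ∉ Eg ∧ (v, a, v) ∉ Eg)) ∧
    ∀ x : γ, (((u, a, x) ∈ Eg ↔ (v, a, x) ∈ Eg) ∧ ((x, a, u) ∈ Eg ↔ (x, a, v) ∈ Eg)) := by
  refine forall_congr' fun a => ?_
  constructor
  · rintro ⟨h1, h2⟩
    refine ⟨h1, fun x => ?_⟩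
    by_cases hu : x = u
    · subst hu; tauto
    by_cases hv : x = v
    · subst hv; tauto
    exact h2 x hu hv
  · rintro ⟨h1, h2⟩
    exact ⟨h1, fun x _ _ => h2 x⟩

theorem numClasses_pullback {γ l p : Type*} [Finite p] (Q : p → l → p → Prop) (ρ : γ → p) :
    numClasses (indistE {t : γ × l × γ | Q (ρ t.1) t.2.1 (ρ t.2.2)}) ≤ Nat.card p := by
  classical
  let K : p → Set γ := fun q => {v | ∀ a : l,
    ((Q q a q ∧ Q q a (ρ v) ∧ Q (ρ v) a q ∧ Q (ρ v) a (ρ v)) ∨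
     (¬ Q q a q ∧ ¬ Q q a (ρ v) ∧ ¬ Q (ρ v) a q ∧ ¬ Q (ρ v) a (ρ v))) ∧
    ∀ x : γ, ((Q q a (ρ x) ↔ Q (ρ v) a (ρ x)) ∧ (Q (ρ x) a q ↔ Q (ρ x) a (ρ v)))}
  unfold numClasses
  have hsub : (Set.range fun u => {v | indistE {t : γ × l × γ | Q (ρ t.1) t.2.1 (ρ t.2.2)} u v})
      ⊆ Set.range K := by
    rintro _ ⟨u, rfl⟩
    refine ⟨ρ u, ?_⟩
    ext v
    exact (indistE_iff {t : γ × l × γ | Q (ρ t.1) t.2.1 (ρ t.2.2)} u v).symm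
  exact (Nat.card_mono (Set.finite_range K) hsub).trans (Finite.card_range_le K)

theorem exists_of_few {V : Type*} [Finite V] (H : SimpleGraph V)
    (Eg : Set (Vert H × Lab H × Vert H)) (hE : Epsg H ⊆ Eg) (hF : Fpsg H ∩ Eg = ∅)
    (hn : numClasses (indistE Eg) ≤ 3 * Nat.card V) (s : Vert H) :
    ∃ v i, indistE Eg s (xv H v i) := by
  have hF' : ∀ t, t ∈ Fpsg H → t ∉ Eg := fun t h1 h2 => by
    have : t ∈ Fpsg H ∩ Eg := ⟨h1, h2⟩
    rw [hF] at this
    exact this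
  have : Finite (Vert H) := by unfold Vert; infer_instance
  let f : V × Fin 3 → (Set.range fun u => {v | indistE Eg u v}) :=
    fun p => ⟨_, xv H p.1 p.2, rfl⟩
  have hf : Function.Injective f := by
    rintro ⟨v, i⟩ ⟨w, j⟩ h
    have h1 : {t | indistE Eg (xv H v i) t} = {t | indistE Eg (xv H w j) t} :=
      congrArg Subtype.val h
    have h2 : indistE Eg (xv H v i) (xv H w j) := by
      have : xv H w j ∈ {t | indistE Eg (xv H w j) t} := indistE_refl _ _
      rw [← h1] at this
      exact this
    have e1 : (xv H v i, av H v, xv H v i) ∈ Eg := hE (Or.inl ⟨v, i, rfl⟩)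
    have h3 := (h2 (av H v)).1
    by_cases hvw : v = w
    · subst hvw
      by_cases hij : i = j
      · rw [hij]
      · have := hF' (xv H v i, av H v, xv H v j) (Or.inr (Or.inl ⟨v, i, j, hij, rfl⟩))
        tauto
    · have := hF' (xv H w j, av H v, xv H w j) (Or.inl ⟨v, w, j, hvw, rfl⟩)
      tauto
  have hb := hf.bijective_of_nat_card_le (by
    have : Nat.card (V × Fin 3) = 3 * Nat.card V := by
      rw [Nat.card_prod, Nat.card_fin, mul_comm]
    rw [this]; exact hn)
  obtain ⟨⟨v, i⟩, h⟩ := hb.2 ⟨_, s, rfl⟩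
  have h1 : {t | indistE Eg (xv H v i) t} = {t | indistE Eg s t} := congrArg Subtype.val h
  refine ⟨v, i, ?_⟩
  have : xv H v i ∈ {t | indistE Eg (xv H v i) t} := indistE_refl _ _
  rw [h1] at this
  exact this

/-- `H` is 3-colorable iff the constructed partially
specified digraph has an instantiation `G` (an edge set containing `E(PSG)`
and avoiding `F(PSG)`) such that `≡_G` induces at most `3·|V|` equivalence
classes. -/
theorem three_colorable_iff_dbpm [Finite V] :
    (∃ c : V → Fin 3, ∀ u v : V, H.Adj u v → c u ≠ c v) ↔
    ∃ Eg : Set (Vert H × Lab H × Vert H),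
      Epsg H ⊆ Eg ∧ Fpsg H ∩ Eg = ∅ ∧
      numClasses (indistE Eg) ≤ 3 * Nat.card V := by
  constructor
  · rintro ⟨c, hc⟩
    have hz : ∀ (e : H.edgeSet) (i : Fin 3), ∃ u : V, u ∈ (e : Sym2 V) ∧ c u ≠ i := by
      rintro ⟨e, he⟩ i
      induction e using Sym2.ind with
      | _ a b =>
        have hab := hc a b (by simpa using he)
        by_cases h : c a = i
        · exact ⟨b, by simp, fun h' => hab (h.trans h'.symm)⟩
        · exact ⟨a, by simp, h⟩
    choose z hz1 hz2 using hz
    let ρ : Vert H → V × Fin 3 :=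
      Sum.elim id (Sum.elim (fun v => (v, c v)) (fun p => (z p.1 p.2, p.2)))
    let Q : V × Fin 3 → Lab H → V × Fin 3 → Prop := fun p l q =>
      p = q ∧ Sum.elim (fun u => p.1 = u) (fun e => ∃ k, p = (z e k, k)) l
    refine ⟨{t | Q (ρ t.1) t.2.1 (ρ t.2.2)}, ?_, ?_, ?_⟩
    · rintro t (⟨v, i, rfl⟩ | ⟨v, rfl⟩ | ⟨e, i, rfl⟩)
      · exact ⟨rfl, rfl⟩
      · exact ⟨rfl, rfl⟩
      · exact ⟨rfl, i, rfl⟩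
    · rw [Set.eq_empty_iff_forall_notMem]
      rintro t ⟨(⟨u, v, i, h, rfl⟩ | ⟨v, i, j, h, rfl⟩ | ⟨u, v, h, rfl⟩ | ⟨v, e, h, rfl⟩ |
        ⟨u, e, i, h, rfl⟩ | ⟨v, e, i, j, h, hij, rfl | rfl⟩), hq, hl⟩
      · exact h (Eq.symm hl)
      · exact h (congrArg Prod.snd hq)
      · exact h (Eq.symm hl)
      · obtain ⟨k, hk⟩ := hl
        have h1 : v = z e k := congrArg Prod.fst hk
        have h2 : c v = k := congrArg Prod.snd hk
        exact hz2 e k (h1 ▸ h2)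
      · have h1 : z e i = u := hl
        exact h (h1 ▸ hz1 e i)
      · exact hij (congrArg Prod.snd hq)
      · exact hij (congrArg Prod.snd hq).symm
    · refine (numClasses_pullback Q ρ).trans (le_of_eq ?_)
      rw [Nat.card_prod, Nat.card_fin, mul_comm]
  · rintro ⟨Eg, hE, hF, hn⟩
    have key := exists_of_few H Eg hE hF hn
    have hF' : ∀ t, t ∈ Fpsg H → t ∉ Eg := fun t h1 h2 => by
      have : t ∈ Fpsg H ∩ Eg := ⟨h1, h2⟩
      rw [hF] at this
      exact this
    have hx : ∀ v i, (xv H v i, av H v, xv H v i) ∈ Eg := fun v i => hE (Or.inl ⟨v, i, rfl⟩)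
    have hy : ∀ v, ∃ i, indistE Eg (yv H v) (xv H v i) := by
      intro v
      obtain ⟨u, i, h⟩ := key (yv H v)
      by_cases huv : u = v
      · subst huv; exact ⟨i, h⟩
      · have := hF' (yv H v, av H u, yv H v) (Or.inr (Or.inr (Or.inl ⟨u, v, huv, rfl⟩)))
        have h1 := (h (av H u)).1
        have := hx u i
        tauto
    have hz : ∀ (e : H.edgeSet) (i : Fin 3), ∃ u, u ∈ (e : Sym2 V) ∧ indistE Eg (zv H e i) (xv H u i) := by
      intro e i
      obtain ⟨u, j, h⟩ := key (zv H e i)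
      have h1 := (h (av H u)).1
      have h2 := hx u j
      by_cases hu : u ∈ (e : Sym2 V)
      · by_cases hij : i = j
        · subst hij; exact ⟨u, hu, h⟩
        · have := hF' (zv H e i, av H u, xv H u j)
            (Or.inr (Or.inr (Or.inr (Or.inr (Or.inr ⟨u, e, i, j, hu, hij, Or.inl rfl⟩)))))
          tauto
      · have := hF' (zv H e i, av H u, zv H e i)
          (Or.inr (Or.inr (Or.inr (Or.inr (Or.inl ⟨u, e, i, hu, rfl⟩)))))
        tauto
    choose c hc using hy
    refine ⟨c, fun v w hvw heq => ?_⟩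
    let e : H.edgeSet := ⟨s(v, w), hvw⟩
    obtain ⟨u, hu, h⟩ := hz e (c v)
    have hcu : c u = c v := by
      rcases Sym2.mem_iff.1 hu with rfl | rfl
      · rfl
      · exact heq.symm
    have h1 := (h (bv H e)).1
    have h2 := (hc u (bv H e)).1
    rw [hcu] at h2
    have h3 : (zv H e (c v), bv H e, zv H e (c v)) ∈ Eg := hE (Or.inr (Or.inr ⟨e, c v, rfl⟩))
    have h4 := hF' (yv H u, bv H e, yv H u) (Or.inr (Or.inr (Or.inr (Or.inl ⟨u, e, hu, rfl⟩))))
    tauto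

end DBPMReduction
end

section
/- Let G = (V, E) be a finite undirected graph with vertices 1, …, |V| and edges numbered 1, …, |E| (the i-th edge being u_i v_i with u_i < v_i), and let PSM be the n × n partially specified access control matrix constructed from G as in the context, where n = 3 + |V| + 3·|E|. Then G is 3-colorable if and only if PSM has an instantiation M with r(M) ≤ 3. -/
namespace DBReduction

/-- The entries of the partially specified access control matrix `PSM`
constructed from an undirected graph with `nv` vertices (`0, …, nv−1`) and
`ne` edges, the `i`-th edge being `{eu i, ev i}` with `eu i < ev i`.
Rows and columns are 0-indexed; `some b` is the boolean entry `b`, and `none`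
is the wildcard `*`.
* All columns `c ≥ 3 + nv` (the rightmost `3·ne` columns) are `0`.
* Rows `0, 1, 2` are the color rows: entry `(i, i)` is `1`, entries `(i, j)`
  for `j < 3`, `j ≠ i` are `0`, and entries in the vertex columns are `*`.
* Rows `3 + w` for `w < nv` are the vertex rows: entry `(3 + w, 3 + w)` is
  `1` and all other columns `< 3 + nv` are `*`.
* Rows `3 + nv + 3·i + k` for `i < ne`, `k < 3` are the edge rows of edge `i`:
  columns `3 + eu i` and `3 + ev i` hold `(1,0)`, `(0,1)`, `(0,0)` for
  `k = 0, 1, 2` respectively, and all other columns `< 3 + nv` are `*`. -/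
def psmEntry (nv ne : ℕ) (eu ev : Fin ne → Fin nv) (r c : ℕ) : Option Bool :=
  if 3 + nv ≤ c then some false
  else if r < 3 then
    (if c < 3 then some (decide (r = c)) else none)
  else if r < 3 + nv then
    (if c = r then some true else none)
  else
    (if h : (r - (3 + nv)) / 3 < ne then
      (if c = 3 + (eu ⟨(r - (3 + nv)) / 3, h⟩).val then
         some (decide ((r - (3 + nv)) % 3 = 0))
       else if c = 3 + (ev ⟨(r - (3 + nv)) / 3, h⟩).val then
         some (decide ((r - (3 + nv)) % 3 = 1))
       else none)
     else none)

theorem pigeon {n : ℕ} {M : Fin n → Fin n → Bool}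
    (h : numClasses (fun u v : Fin n => ∀ x, M u x = M v x) ≤ 3) (f : Fin 4 → Fin n) :
    ∃ a b, a ≠ b ∧ M (f a) = M (f b) := by
  by_contra hc
  push Not at hc
  have key : Function.Injective (fun a : Fin 4 =>
      (⟨{v | ∀ x, M (f a) x = M v x}, ⟨f a, rfl⟩⟩ :
        Set.range fun u : Fin n => {v | ∀ x, M u x = M v x})) := by
    intro a b hab
    by_contra hne
    apply hc a b hne
    have h1 := congrArg Subtype.val hab
    have h2 : f b ∈ {v | ∀ x, M (f a) x = M v x} := by
      have h3 : f b ∈ {v | ∀ x, M (f b) x = M v x} := fun x => rfl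
      exact h1.symm.subset h3
    exact funext h2
  have := Nat.card_le_card_of_injective _ key
  unfold numClasses at h
  simp only [Nat.card_fin] at this
  exact absurd (this.trans h) (by norm_num)

theorem bound {n : ℕ} {M : Fin n → Fin n → Bool} (P : Fin 3 → Fin n → Bool)
    (k : Fin n → Fin 3) (h : ∀ r, M r = P (k r)) :
    numClasses (fun u v : Fin n => ∀ x, M u x = M v x) ≤ 3 := by
  unfold numClasses
  rw [Nat.card_coe_set_eq]
  have hsub : (Set.range fun u : Fin n => {v | ∀ x, M u x = M v x}) ⊆
      Set.range (fun j : Fin 3 => {v : Fin n | ∀ x, P j x = M v x}) := by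
    rintro _ ⟨u, rfl⟩
    exact ⟨k u, by simp only [h u]⟩
  refine (Set.ncard_le_ncard hsub (Set.toFinite _)).trans ?_
  rw [← Set.image_univ]
  refine (Set.ncard_image_le (Set.toFinite _)).trans ?_
  simp [Set.ncard_univ]

theorem third : ∀ a b : Fin 3, a ≠ b → a ≠ -(a + b) ∧ b ≠ -(a + b) := by decide

/-- color assigned to each row -/
def rowColor (nv ne : ℕ) (eu ev : Fin ne → Fin nv) (c : Fin nv → Fin 3) (r : ℕ) : Fin 3 :=
  if h : r < 3 then ⟨r, h⟩
  else if h : r < 3 + nv then c ⟨r - 3, by omega⟩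
  else if h : (r - (3 + nv)) / 3 < ne then
    (if (r - (3 + nv)) % 3 = 0 then c (eu ⟨_, h⟩)
     else if (r - (3 + nv)) % 3 = 1 then c (ev ⟨_, h⟩)
     else -(c (eu ⟨_, h⟩) + c (ev ⟨_, h⟩)))
  else 0

/-- row pattern of each color -/
def pat (nv : ℕ) (c : Fin nv → Fin 3) (j : Fin 3) (x : ℕ) : Bool :=
  if h3 : x < 3 then decide (j.val = x)
  else if h : x < 3 + nv then decide (c ⟨x - 3, by omega⟩ = j)
  else false

theorem pat_vertex (nv : ℕ) (c : Fin nv → Fin 3) (j : Fin 3) (w : Fin nv) :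
    pat nv c j (3 + w.val) = decide (c w = j) := by
  have : (⟨3 + w.val - 3, by omega⟩ : Fin nv) = w := by ext; simp
  simp [pat]

theorem inst (nv ne : ℕ) (eu ev : Fin ne → Fin nv)
    (c : Fin nv → Fin 3) (hc : ∀ i : Fin ne, c (eu i) ≠ c (ev i)) (r x : ℕ) (b : Bool)
    (h : psmEntry nv ne eu ev r x = some b) :
    pat nv c (rowColor nv ne eu ev c r) x = b := by
  unfold psmEntry at h
  split_ifs at h with h1 h2 h3 h4 h5 h6 h7 h8
  · have g1 : ¬ x < 3 := by omega
    have g2 : ¬ x < 3 + nv := by omega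
    have e := Option.some.inj h
    simp only [pat, g1, g2, dite_false, e]
  · simp_all [pat, rowColor]
  · subst h5
    simp_all [pat, rowColor]
  · subst h7
    rw [pat_vertex]
    obtain ⟨t1, t2⟩ := third _ _ (hc ⟨_, h6⟩)
    have := hc ⟨_, h6⟩
    have e := Option.some.inj h
    rw [← e]
    simp only [rowColor, h2, h4, h6, dite_true, dite_false]
    split_ifs <;> simp_all
  · subst h8
    rw [pat_vertex]
    obtain ⟨t1, t2⟩ := third _ _ (hc ⟨_, h6⟩)
    have := hc ⟨_, h6⟩
    have e := Option.some.inj h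
    rw [← e]
    simp only [rowColor, h2, h4, h6, dite_true, dite_false]
    split_ifs <;> simp_all [Ne.symm]

theorem color_row {n : ℕ} (hn : 3 ≤ n) {M : Fin n → Fin n → Bool}
    (h : numClasses (fun u v : Fin n => ∀ x, M u x = M v x) ≤ 3)
    (hM : ∀ i j : Fin 3, M (Fin.castLE hn i) (Fin.castLE hn j) = decide (i = j)) (r : Fin n) :
    ∃ j : Fin 3, M r = M (Fin.castLE hn j) := by
  obtain ⟨a, b, hab, e⟩ := pigeon h (Fin.snoc (α := fun _ => Fin n) (Fin.castLE hn) r)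
  induction a using Fin.lastCases with
  | last =>
    induction b using Fin.lastCases with
    | last => exact absurd rfl hab
    | cast j => exact ⟨j, by simpa only [Fin.snoc_castSucc, Fin.snoc_last] using e⟩
  | cast i =>
    induction b using Fin.lastCases with
    | last => exact ⟨i, by simpa only [Fin.snoc_castSucc, Fin.snoc_last] using e.symm⟩
    | cast j =>
      exfalso
      simp only [Fin.snoc_castSucc] at e
      have := congrFun e (Fin.castLE hn i)
      rw [hM, hM] at this
      simp at this
      exact hab (by rw [this])

/-- Let `G` be a finite undirected graph with `nv` vertices
and `ne` numbered edges (the `i`-th edge being `{eu i, ev i}` with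
`eu i < ev i`), and let `PSM` be the `n × n` partially specified access
control matrix constructed from `G`, where `n = 3 + nv + 3·ne`. Then `G` is
3-colorable iff `PSM` has an instantiation `M` with `r(M) ≤ 3`. -/
theorem three_colorable_iff_db (nv ne : ℕ) (eu ev : Fin ne → Fin nv)
    (hlt : ∀ i : Fin ne, (eu i : ℕ) < (ev i : ℕ)) :
    (∃ c : Fin nv → Fin 3, ∀ i : Fin ne, c (eu i) ≠ c (ev i)) ↔
    ∃ M : Fin (3 + nv + 3 * ne) → Fin (3 + nv + 3 * ne) → Bool,
      (∀ (r c : Fin (3 + nv + 3 * ne)) (b : Bool),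
        psmEntry nv ne eu ev r.val c.val = some b → M r c = b) ∧
      numClasses (fun u v : Fin (3 + nv + 3 * ne) => ∀ x, M u x = M v x) ≤ 3 := by
  constructor
  · rintro ⟨c, hc⟩
    refine ⟨fun r x => pat nv c (rowColor nv ne eu ev c r.val) x.val, ?_, ?_⟩
    · intro r x b h
      exact inst nv ne eu ev c hc r x b h
    · exact bound (fun j x => pat nv c j x.val) (fun r => rowColor nv ne eu ev c r.val)
        (fun r => rfl)
  · rintro ⟨M, hM, hcard⟩
    have hn : 3 ≤ 3 + nv + 3 * ne := by omega
    have hcol := color_row hn hcard (by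
      intro i j
      apply hM
      have h1 := i.isLt
      have h2 := j.isLt
      have h3 : ¬ (3 + nv ≤ j.val) := by omega
      simp [psmEntry, h3, Fin.ext_iff])
    choose k hk using hcol
    refine ⟨fun w => k ⟨3 + w.val, by omega⟩, ?_⟩
    intro i heq
    have hi := i.isLt
    have hu := (eu i).isLt
    have hv := (ev i).isLt
    have hl := hlt i
    have hrow : M ⟨3 + (eu i).val, by omega⟩ = M ⟨3 + (ev i).val, by omega⟩ := by
      rw [hk ⟨3 + (eu i).val, by omega⟩, hk ⟨3 + (ev i).val, by omega⟩]
      exact congrArg (fun j => M (Fin.castLE hn j)) heq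
    have hvert : ∀ w : Fin nv, M ⟨3 + w.val, by omega⟩ ⟨3 + w.val, by omega⟩ = true := by
      intro w
      apply hM
      simp [psmEntry]
    have hvu := hvert (eu i)
    have hvv := hvert (ev i)
    rw [← hrow] at hvv
    have heu : ∀ t : Fin 3, M ⟨3 + nv + 3 * i.val + t.val, by omega⟩ ⟨3 + (eu i).val, by omega⟩
        = decide (t.val = 0) := by
      intro t
      apply hM
      have a1 : (3 + nv + 3 * i.val + t.val - (3 + nv)) / 3 = i.val := by omega
      have a2 : (3 + nv + 3 * i.val + t.val - (3 + nv)) % 3 = t.val := by omega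
      have a3 : ¬ (3 + nv + 3 * i.val + t.val < 3) := by omega
      have a4 : ¬ (3 + nv + 3 * i.val + t.val < 3 + nv) := by omega
      have a5 : ¬ (3 + nv ≤ 3 + (eu i).val) := by omega
      simp only [psmEntry, a1, a2, a3, a4, a5, hi, if_false, dite_true, if_true]
    have hev : ∀ t : Fin 3, M ⟨3 + nv + 3 * i.val + t.val, by omega⟩ ⟨3 + (ev i).val, by omega⟩
        = decide (t.val = 1) := by
      intro t
      apply hM
      have a1 : (3 + nv + 3 * i.val + t.val - (3 + nv)) / 3 = i.val := by omega
      have a2 : (3 + nv + 3 * i.val + t.val - (3 + nv)) % 3 = t.val := by omega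
      have a3 : ¬ (3 + nv + 3 * i.val + t.val < 3) := by omega
      have a4 : ¬ (3 + nv + 3 * i.val + t.val < 3 + nv) := by omega
      have a5 : ¬ (3 + nv ≤ 3 + (ev i).val) := by omega
      have a6 : ¬ (3 + (ev i).val = 3 + (eu i).val) := by omega
      simp only [psmEntry, a1, a2, a3, a4, a5, a6, hi, if_false, dite_true, if_true]
    obtain ⟨a, b, hab, e⟩ := pigeon hcard (Fin.snoc (α := fun _ => Fin (3 + nv + 3 * ne))
      (fun t : Fin 3 => ⟨3 + nv + 3 * i.val + t.val, by omega⟩) ⟨3 + (eu i).val, by omega⟩)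
    have e1 := congrFun e ⟨3 + (eu i).val, by omega⟩
    have e2 := congrFun e ⟨3 + (ev i).val, by omega⟩
    induction a using Fin.lastCases with
    | last =>
      induction b using Fin.lastCases with
      | last => exact absurd rfl hab
      | cast j =>
        simp only [Fin.snoc_castSucc, Fin.snoc_last, heu, hev, hvu, hvv] at e1 e2
        revert e1 e2; clear * -; revert j; decide
    | cast t =>
      induction b using Fin.lastCases with
      | last =>
        simp only [Fin.snoc_castSucc, Fin.snoc_last, heu, hev, hvu, hvv] at e1 e2
        revert e1 e2; clear * -; revert t; decide
      | cast j =>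
        simp only [Fin.snoc_castSucc, heu, hev] at e1 e2
        revert hab e1 e2; clear * -; revert t j; decide

end DBReduction
end

section
/- Let PSM be an n × n partially specified access control matrix (over a singleton access-right set) and let PSM' be the (3n+1) × (3n+1) partially specified access control matrix constructed from PSM as in the context. Then for every instantiation M of PSM, the corresponding instantiation M' of PSM' satisfies r(M') = r(M) + 2n + 1 and c(M') = c(M) + n + 1; hence r(M') > c(M') and max(r(M'), c(M')) = r(M) + 2n + 1. -/
/-- Row equivalence of a 2-dimensional boolean matrix (the access-right set is
a singleton): rows `u` and `v` agree in every column. -/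
def rowEquiv2 {ι : Type*} (M : ι → ι → Bool) (u v : ι) : Prop :=
  ∀ x : ι, M u x = M v x

/-- Column equivalence of a 2-dimensional boolean matrix: columns `u` and `v`
agree in every row. -/
def colEquiv2 {ι : Type*} (M : ι → ι → Bool) (u v : ι) : Prop :=
  ∀ x : ι, M x u = M x v

namespace DTEPMReduction

/-- The fully specified `(2n+1) × (2n+1)` boolean matrix `M⋆` (0-indexed):
* for `i < n`, row `i` has `1` exactly at columns `i` and `2n − i`;
* for `n ≤ i < 2n` (i.e. row `n + k` with `k = i − n + 1 ∈ {1, …, n}`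
  1-indexed), the row has `1` exactly in columns `i − n + 1` through
  `3n − 1 − i`;
* row `2n` (the last row) is all `1`s. -/
def mstar (n i j : ℕ) : Bool :=
  if i = 2 * n then true
  else if i < n then decide (j = i ∨ j = 2 * n - i)
  else decide (i - n + 1 ≤ j ∧ j + i + 1 ≤ 3 * n)

/-- The `(3n+1) × (3n+1)` partially specified access control matrix
`PSM' = [[PSM, 0], [0ᵀ, M⋆]]` in block form, where `0` is an `n × (2n+1)`
zero matrix and `M⋆` is `mstar`. -/
def psm' (n : ℕ) (PSM : Fin n → Fin n → Option Bool)
    (r c : Fin (3 * n + 1)) : Option Bool :=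
  if hr : (r : ℕ) < n then
    (if hc : (c : ℕ) < n then PSM ⟨r, hr⟩ ⟨c, hc⟩ else some false)
  else
    (if (c : ℕ) < n then some false
     else some (mstar n ((r : ℕ) - n) ((c : ℕ) - n)))

/-- Given an instantiation `M` of `PSM`, the corresponding instantiation `M'`
of `PSM'`: the `PSM` block is replaced by `M` and all fully specified entries
are kept. -/
def minst (n : ℕ) (M : Fin n → Fin n → Bool)
    (r c : Fin (3 * n + 1)) : Bool :=
  if hr : (r : ℕ) < n then
    (if hc : (c : ℕ) < n then M ⟨r, hr⟩ ⟨c, hc⟩ else false)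
  else
    (if (c : ℕ) < n then false
     else mstar n ((r : ℕ) - n) ((c : ℕ) - n))

theorem num_of {γ β : Type*} (r : γ → γ → Prop) (f : γ → β) (hf : Function.Surjective f)
    (h : ∀ u v, r u v ↔ f u = f v) : numClasses r = Nat.card β := by
  unfold numClasses
  symm
  refine Nat.card_congr (Equiv.ofBijective
    (fun b => ⟨{v | r (Function.surjInv hf b) v}, ⟨_, rfl⟩⟩) ⟨?_, ?_⟩)
  · intro a b hab
    have h1 : {v | r (Function.surjInv hf a) v} = {v | r (Function.surjInv hf b) v} :=
      congrArg Subtype.val hab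
    have h2 : Function.surjInv hf b ∈ {v | r (Function.surjInv hf a) v} := by
      rw [h1]; exact (h _ _).2 rfl
    have h3 := (h _ _).1 h2
    rwa [Function.surjInv_eq hf a, Function.surjInv_eq hf b] at h3
  · rintro ⟨_, u, rfl⟩
    refine ⟨f u, Subtype.ext ?_⟩
    ext v
    simp only [Set.mem_ofPred_eq, h, Function.surjInv_eq]

theorem block {n k : ℕ} (r : Fin n → Fin n → Prop) (he : Equivalence r)
    (R : Fin (3 * n + 1) → Fin (3 * n + 1) → Prop)
    (p : ℕ → ℕ) (hp : ∀ j, j < 2 * n + 1 → p j < k)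
    (hs : ∀ i, i < k → ∃ j, j < 2 * n + 1 ∧ p j = i)
    (h1 : ∀ (u v : Fin (3 * n + 1)) (hu : u.1 < n) (hv : v.1 < n),
      R u v ↔ r ⟨u, hu⟩ ⟨v, hv⟩)
    (h2 : ∀ (u v : Fin (3 * n + 1)), u.1 < n → ¬ v.1 < n → ¬ R u v ∧ ¬ R v u)
    (h3 : ∀ (u v : Fin (3 * n + 1)), ¬ u.1 < n → ¬ v.1 < n →
      (R u v ↔ p (u - n) = p (v - n))) :
    numClasses R = numClasses r + k := by
  have hg : ∀ u v, r u v ↔ {w | r u w} = {w | r v w} := by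
    intro u v
    constructor
    · intro h
      ext w
      exact ⟨fun h' => he.trans (he.symm h) h', fun h' => he.trans h h'⟩
    · intro h
      have : v ∈ {w | r u w} := by rw [h]; exact he.refl v
      exact this
  rw [num_of R (β := (Set.range fun u => {v | r u v}) ⊕ Fin k)
    (fun u => if hu : u.1 < n then Sum.inl ⟨{w | r ⟨u, hu⟩ w}, ⟨_, rfl⟩⟩
      else Sum.inr ⟨p (u - n), hp _ (by omega)⟩), Nat.card_sum, Nat.card_fin]
  · rfl
  · rintro (⟨_, u, rfl⟩ | i)
    · refine ⟨⟨u, by omega⟩, ?_⟩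
      simp
    · obtain ⟨j, hj, hji⟩ := hs i i.2
      refine ⟨⟨j + n, by omega⟩, ?_⟩
      simp [hji]
  · intro u v
    by_cases hu : u.1 < n <;> by_cases hv : v.1 < n
    · rw [h1 u v hu hv, hg]
      simp only [hu, hv, dite_true, Sum.inl.injEq]
      exact ⟨fun h => Subtype.ext h, fun h => congrArg Subtype.val h⟩
    · simp [hu, hv, h2 u v hu hv]
    · simp [hu, hv, h2 v u hv hu]
    · simp [hu, hv, h3 u v hu hv]

theorem mstar_row {n i i' : ℕ} (hi : i < 2 * n + 1) (hi' : i' < 2 * n + 1)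
    (h : ∀ j, j < 2 * n + 1 → mstar n i j = mstar n i' j) : i = i' := by
  have a0 := h 0 (by omega)
  have an := h n (by omega)
  have ai := h i hi
  have ai' := h i' hi'
  by_cases c1 : i < n
  · grind [mstar]
  by_cases c1' : i' < n
  · grind [mstar]
  by_cases c2 : i = 2 * n
  · grind [mstar]
  by_cases c2' : i' = 2 * n
  · grind [mstar]
  have b := h (i - n + 1) (by omega)
  have b' := h (i' - n + 1) (by omega)
  simp only [mstar, c1, c1', c2, c2', if_false, decide_eq_decide] at b b'
  omega

theorem mstar_col {n j j' : ℕ} (hi : j < 2 * n + 1) (hi' : j' < 2 * n + 1) :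
    (∀ i, i < 2 * n + 1 → mstar n i j = mstar n i j') ↔ min j (2 * n - j) = min j' (2 * n - j') := by
  constructor
  · intro h
    have key : ∀ i, i < n → ((j = i ∨ j = 2 * n - i) ↔ (j' = i ∨ j' = 2 * n - i)) := by
      intro i hi
      have a := h i (by omega)
      have e : ¬ i = 2 * n := by omega
      simpa only [mstar, hi, e, if_true, if_false, decide_eq_decide] using a
    have a := key (min j (2 * n - j))
    have b := key (min j' (2 * n - j'))
    omega
  · intro h i hi
    have : j' = j ∨ j' = 2 * n - j := by omega
    rcases this with rfl | rfl
    · rfl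
    · unfold mstar
      split_ifs
      · rfl
      · rw [decide_eq_decide]; omega
      · rw [decide_eq_decide]; omega

theorem minst_hh {n : ℕ} (M : Fin n → Fin n → Bool) (u v : Fin (3 * n + 1)) (hu : ¬ u.1 < n)
    (hv : ¬ v.1 < n) : minst n M u v = mstar n (u - n) (v - n) := by
  simp [minst, hu, hv]

theorem mstar_last (n j : ℕ) : mstar n (2 * n) j = true := by simp [mstar]

theorem mstar_nz {n i : ℕ} (hi : i < 2 * n + 1) : ∃ j, j < 2 * n + 1 ∧ mstar n i j = true := by
  by_cases c : i < n
  · exact ⟨i, hi, by grind [mstar]⟩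
  · exact ⟨n, by omega, by grind [mstar]⟩

theorem row_count (n : ℕ) (M : Fin n → Fin n → Bool) :
    numClasses (rowEquiv2 (minst n M)) = numClasses (rowEquiv2 M) + (2 * n + 1) := by
  refine block _ ⟨fun _ _ => rfl, fun h x => (h x).symm, fun h h' x => (h x).trans (h' x)⟩ _
    (fun j => j) (fun _ h => h) (fun i h => ⟨i, h, rfl⟩) ?_ ?_ ?_
  · intro u v hu hv
    constructor
    · intro h x
      have := h ⟨x, by omega⟩
      simpa [minst, hu, hv] using this
    · intro h x
      by_cases hx : x.1 < n
      · simpa [minst, hu, hv, hx] using h ⟨x, hx⟩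
      · simp [minst, hu, hv, hx]
  · intro u v hu hv
    obtain ⟨j, hj, e⟩ := mstar_nz (n := n) (i := v - n) (by omega)
    constructor <;> intro h <;> have := h ⟨j + n, by omega⟩ <;> simp [minst, hu, hv, e] at this
  · intro u v hu hv
    constructor
    · intro h
      refine mstar_row (n := n) (by omega) (by omega) fun j hj => ?_
      have := h ⟨j + n, by omega⟩
      simpa [minst, hu, hv] using this
    · intro h x
      have : u = v := by ext; omega
      rw [this]

theorem col_count (n : ℕ) (M : Fin n → Fin n → Bool) :
    numClasses (colEquiv2 (minst n M)) = numClasses (colEquiv2 M) + (n + 1) := by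
  refine block _ ⟨fun _ _ => rfl, fun h x => (h x).symm, fun h h' x => (h x).trans (h' x)⟩ _
    (fun j => min j (2 * n - j)) (fun _ h => by omega) (fun i h => ⟨i, by omega, by omega⟩) ?_ ?_ ?_
  · intro u v hu hv
    constructor
    · intro h x
      have := h ⟨x, by omega⟩
      simpa [minst, hu, hv] using this
    · intro h x
      by_cases hx : x.1 < n
      · simpa [minst, hu, hv, hx] using h ⟨x, hx⟩
      · simp [minst, hu, hv, hx]
  · intro u v hu hv
    constructor <;> intro h <;> have := h ⟨2 * n + n, by omega⟩ <;>
      simp [minst, hu, hv, mstar_last] at this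
  · intro u v hu hv
    rw [← mstar_col (n := n) (by omega) (by omega)]
    constructor
    · intro h j hj
      have := h ⟨j + n, by omega⟩
      simpa [minst, hu, hv] using this
    · intro h x
      by_cases hx : x.1 < n
      · simp [minst, hu, hv, hx]
      · simpa [minst, hu, hv, hx] using h (x - n) (by omega)

/-- For every instantiation `M` of an `n × n` partially
specified access control matrix `PSM` (with `n ≥ 1`), the corresponding
instantiation `M'` of the constructed `(3n+1) × (3n+1)` matrix `PSM'`
satisfies `r(M') = r(M) + 2n + 1` and `c(M') = c(M) + n + 1`; hence
`r(M') > c(M')` and `max(r(M'), c(M')) = r(M) + 2n + 1`. -/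
theorem rc_of_minst (n : ℕ) (hn : 0 < n)
    (PSM : Fin n → Fin n → Option Bool) (M : Fin n → Fin n → Bool)
    (hM : ∀ (i j : Fin n) (b : Bool), PSM i j = some b → M i j = b) :
    numClasses (rowEquiv2 (minst n M)) = numClasses (rowEquiv2 M) + 2 * n + 1 ∧
    numClasses (colEquiv2 (minst n M)) = numClasses (colEquiv2 M) + n + 1 ∧
    numClasses (colEquiv2 (minst n M)) < numClasses (rowEquiv2 (minst n M)) ∧
    max (numClasses (rowEquiv2 (minst n M))) (numClasses (colEquiv2 (minst n M)))
      = numClasses (rowEquiv2 M) + 2 * n + 1 := by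
  have hr := row_count n M
  have hc := col_count n M
  have h1 : numClasses (colEquiv2 M) ≤ n := by
    unfold numClasses
    simpa using Finite.card_range_le (fun u => {v | colEquiv2 M u v})
  have h2 : 0 < numClasses (rowEquiv2 M) := by
    unfold numClasses
    haveI : Nonempty (Set.range fun u => {v | rowEquiv2 M u v}) := ⟨⟨_, ⟨0, hn⟩, rfl⟩⟩
    exact Nat.card_pos
  omega

end DTEPMReduction
end
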